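/- Let G be a graph admitting an incidence coloring with Δ(G)+1 colors, and let H be a graph such that Δ(G)+1 ≥ |V(H)| − 1 − Δ(H). Then χ_i(G □ H) ≤ Δ(G □ H) + 2. -/

import Mathlib

open SimpleGraph

/-- `c v u` is the color of the incidence `(v, vu)` (the incidence of the vertex `v`
with the edge joining `v` and `u`). Two incidences `(v, vu)` and `(x, xy)` are adjacent
iff `v = x`, or the edges coincide, or the edge `vx` is one of the two edges; this
amounts to `v = x ∨ u = x ∨ v = y`. An incidence coloring assigns distinct colors to
distinct adjacent incidences. -/
def IsIncidenceColoring {V : Type*} (G : SimpleGraph V) {k : ℕ} (c : V → V → Fin k) : Prop :=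
  ∀ ⦃v u x y : V⦄, G.Adj v u → G.Adj x y → (v, u) ≠ (x, y) →
    (v = x ∨ u = x ∨ v = y) → c v u ≠ c x y

/-- `G` admits an incidence coloring with `k` colors. -/
def HasIncidenceColoring {V : Type*} (G : SimpleGraph V) (k : ℕ) : Prop :=
  ∃ c : V → V → Fin k, IsIncidenceColoring G c

/-- The incidence chromatic number of `G`. -/
noncomputable def incChromNum {V : Type*} (G : SimpleGraph V) : ℕ :=
  sInf {k | HasIncidenceColoring G k}

/-- If `f` injects the vertices of `H` into `Fin N`, then deleting the colors of a closed
neighborhood from `Fin N` leaves room for `k` colors as soon as `k + Δ(H) + 1 ≤ N`. -/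
theorem exists_embedding_avoiding_closed_neighborhood {W : Type*} [Fintype W]
    (H : SimpleGraph W) [DecidableRel H.Adj] {k N : ℕ} (hN : k + H.maxDegree + 1 ≤ N)
    (f : W → Fin N) (x : W) :
    ∃ g : Fin k ↪ Fin N, ∀ i, g i ≠ f x ∧ ∀ y, H.Adj x y → g i ≠ f y := by
  classical
  let T : Finset (Fin N) := (insert x (H.neighborFinset x)).image f
  have hT : T.card ≤ H.maxDegree + 1 := by
    calc T.card ≤ (insert x (H.neighborFinset x)).card := Finset.card_image_le
      _ ≤ (H.neighborFinset x).card + 1 := Finset.card_insert_le _ _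
      _ ≤ H.maxDegree + 1 := by
        rw [H.card_neighborFinset_eq_degree]
        exact Nat.succ_le_succ (H.degree_le_maxDegree x)
  have hcard : Fintype.card (Fin k) ≤ Fintype.card {i // i ∈ Tᶜ} := by
    rw [Fintype.card_coe, Finset.card_compl, Fintype.card_fin, Fintype.card_fin]
    omega
  obtain ⟨e⟩ := Function.Embedding.nonempty_of_card_le hcard
  refine ⟨e.trans (Function.Embedding.subtype _), fun i => ?_⟩
  have hi := Finset.mem_compl.mp (e i).2
  refine ⟨fun h => hi ?_, fun y hy h => hi ?_⟩
  · exact Finset.mem_image.mpr ⟨x, Finset.mem_insert_self _ _, h.symm⟩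
  · exact Finset.mem_image.mpr
      ⟨y, Finset.mem_insert_of_mem ((H.mem_neighborFinset x y).mpr hy), h.symm⟩

/-- An incidence coloring of `G` with `k` colors extends to `G □ H` with `N` colors whenever
`N` is at least `|V(H)|` and `k + Δ(H) + 1`. -/
theorem HasIncidenceColoring.boxProd {U W : Type*} [Fintype W]
    {G : SimpleGraph U} (H : SimpleGraph W) [DecidableRel H.Adj] {k N : ℕ}
    (hG : HasIncidenceColoring G k) (hN : k + H.maxDegree + 1 ≤ N)
    (hW : Fintype.card W ≤ N) : HasIncidenceColoring (G.boxProd H) N := by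
  classical
  obtain ⟨c, hc⟩ := hG
  obtain ⟨f⟩ : Nonempty (W ↪ Fin N) :=
    Function.Embedding.nonempty_of_card_le (by rwa [Fintype.card_fin])
  choose g hg using exists_embedding_avoiding_closed_neighborhood H hN f
  refine ⟨fun p q => if p.2 = q.2 then g p.2 (c p.1 q.1) else f q.2, ?_⟩
  rintro ⟨a₁, x₁⟩ ⟨a₂, x₂⟩ ⟨b₁, y₁⟩ ⟨b₂, y₂⟩ h h' hne hadj
  simp only [SimpleGraph.boxProd_adj, Prod.mk.injEq, ne_eq] at h h' hne hadj ⊢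
  rcases h with ⟨ha, rfl⟩ | ⟨hx, rfl⟩ <;> rcases h' with ⟨hb, rfl⟩ | ⟨hy, rfl⟩
  · obtain rfl : x₁ = y₁ := by tauto
    rw [if_pos rfl, if_pos rfl]
    intro heq
    exact hc ha hb (by simpa using hne) (by tauto) ((g x₁).injective heq)
  · rw [if_pos rfl, if_neg hy.ne]
    rcases hadj with ⟨-, rfl⟩ | ⟨-, rfl⟩ | ⟨-, rfl⟩
    · exact (hg _ _).2 _ hy
    · exact (hg _ _).2 _ hy
    · exact (hg _ _).1
  · rw [if_neg hx.ne, if_pos rfl]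
    rcases hadj with ⟨-, rfl⟩ | ⟨-, rfl⟩ | ⟨-, rfl⟩
    · exact ((hg _ _).2 _ hx).symm
    · exact (hg _ _).1.symm
    · exact ((hg _ _).2 _ hx).symm
  · rw [if_neg hx.ne, if_neg hy.ne]
    intro heq
    obtain rfl := f.injective heq
    rcases hadj with ⟨rfl, rfl⟩ | ⟨-, rfl⟩ | ⟨-, rfl⟩
    · simp at hne
    · exact hy.ne rfl
    · exact hx.ne rfl

/-- If `G` is a `(Δ+1)`-graph and `H` satisfies `Δ(G) + 1 ≥ |V(H)| - 1 - Δ(H)`,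
then `χ_i(G □ H) ≤ Δ(G □ H) + 2 = Δ(G) + Δ(H) + 2`. -/
theorem stmt1 {U W : Type*} [Fintype U] [Fintype W]
    (G : SimpleGraph U) (H : SimpleGraph W)
    [DecidableRel G.Adj] [DecidableRel H.Adj]
    (hG : HasIncidenceColoring G (G.maxDegree + 1))
    (hdeg : G.maxDegree + 1 ≥ Fintype.card W - 1 - H.maxDegree) :
    incChromNum (G.boxProd H) ≤ G.maxDegree + H.maxDegree + 2 := by
  exact Nat.sInf_le (hG.boxProd H (by omega) (by omega))
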